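/- (Monotonicity of the gauge function ψ.) Let s ≥ 1, let (l_k, c_k) for k ∈ {1,…,s} be primary parts with l_k ≥ 1, and let I, J ⊆ {1,…,s} be subsets such that I, I+1 = {i+1 : i ∈ I}, and J partition {1,…,s} and l_i = l_{i+1} + δ(c_i, c_{i+1}) for all i ∈ I. Form the sequence of parts in index order: the primary part (l_j, c_j) for each j ∈ J and the secondary part (l_{i+1}, c_i, c_{i+1}) for each i ∈ I, and assume that consecutive parts of this sequence satisfy the relation ≫_c. Define Δ(k,k') = Σ_{t=k}^{k'−1} χ(c_t ≤ c_{t+1}) for k ≤ k' and Δ(k,k') = −Δ(k',k) for k > k', and for (j,i) ∈ J × I set ψ(j,i) = l_j − l_i − Δ(j,i). Then ψ is decreasing in its first argument and increasing in its second argument: for j ≤ j' in J and i in I, ψ(j,i) ≥ ψ(j',i); and for j in J and i ≤ i' in I, ψ(j,i') ≥ ψ(j,i). -/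

import Mathlib

/-- δ(p,q) = 1 if p ≤ q and 0 otherwise. -/
def delta {m : ℕ} (p q : Fin m) : ℤ := if p ≤ q then 1 else 0

/-- Colored parts: a primary part (k,p) of size k, or a secondary part (k,p,q)
of size 2k + δ(p,q). -/
inductive CPart (m : ℕ) : Type where
  | primary (k : ℤ) (p : Fin m) : CPart m
  | secondary (k : ℤ) (p q : Fin m) : CPart m

/-- The size of a colored part. -/
def CPart.size {m : ℕ} : CPart m → ℤ
  | .primary k _ => k
  | .secondary k p q => 2 * k + delta p q

/-- The relation ≫_c between colored parts. -/
def gg {m : ℕ} : CPart m → CPart m → Prop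
  | .primary k p, .primary l q => k - l ≥ 1 + delta p q
  | .primary k p, .secondary l q r => k - (2 * l + delta q r) ≥ delta p q + delta q r
  | .secondary k p q, .primary l r => (2 * k + delta p q) - l ≥ 1 + delta p q + delta q r
  | .secondary k p q, .secondary l r s =>
      (2 * k + delta p q) - (2 * l + delta r s) ≥ delta p q + 2 * delta q r + delta r s

/-- Membership in O' ∪ E' : the integer entry is at least 1. -/
def CPart.mem' {m : ℕ} : CPart m → Prop
  | .primary k _ => 1 ≤ k
  | .secondary k _ _ => 1 ≤ k

/-- The number of times the color `x` is used by a part: secondary parts use two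
colors (so a part of color x² counts twice). -/
def colorCount {m : ℕ} (x : Fin m) : CPart m → ℕ
  | .primary _ p => if p = x then 1 else 0
  | .secondary _ p q => (if p = x then 1 else 0) + (if q = x then 1 else 0)

/-- Δ(i,j) = Σ_{k=i}^{j-1} χ(c_k ≤ c_{k+1}) (for i ≤ j). -/
def Del {m : ℕ} (c : ℕ → Fin m) (i j : ℕ) : ℤ :=
  ∑ k ∈ Finset.Ico i j, (if c k ≤ c (k + 1) then (1 : ℤ) else 0)

/-- The part at index k of the assembled sequence: the primary part (l_k, c_k) if
k ∈ J, and the secondary part (l_{k+1}, c_k, c_{k+1}) if k ∈ I. -/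
def partAt {m : ℕ} (l : ℕ → ℤ) (c : ℕ → Fin m) (J : Finset ℕ) (k : ℕ) : CPart m :=
  if k ∈ J then .primary (l k) (c k) else .secondary (l (k + 1)) (c k) (c (k + 1))

/-- The gauge function ψ(j,i) = l_j − l_i − Δ(j,i), where Δ is extended
antisymmetrically: Δ(k,k') = −Δ(k',k) for k > k'. -/
def psi {m : ℕ} (l : ℕ → ℤ) (c : ℕ → Fin m) (j i : ℕ) : ℤ :=
  l j - l i - (if j ≤ i then Del c j i else -Del c i j)

lemma delta_nonneg {m : ℕ} (p q : Fin m) : 0 ≤ delta p q := by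
  unfold delta; split_ifs <;> norm_num

lemma delta_le_one {m : ℕ} (p q : Fin m) : delta p q ≤ 1 := by
  unfold delta; split_ifs <;> norm_num

/-- The number of weak ascents of the color sequence before position `k`. -/
def ascents {m : ℕ} (c : ℕ → Fin m) (k : ℕ) : ℤ :=
  ∑ t ∈ Finset.range k, delta (c t) (c (t + 1))

lemma ascents_succ {m : ℕ} (c : ℕ → Fin m) (k : ℕ) :
    ascents c (k + 1) = ascents c k + delta (c k) (c (k + 1)) :=
  Finset.sum_range_succ _ _

lemma ascents_sub_le {m : ℕ} (c : ℕ → Fin m) {a b : ℕ} (hab : a ≤ b) :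
    ascents c b - ascents c a ≤ b - a := by
  induction b, hab using Nat.le_induction with
  | base => simp
  | succ b _ ih =>
    have := delta_le_one (c b) (c (b + 1))
    rw [ascents_succ]
    push_cast
    linarith

lemma Del_eq_ascents_sub {m : ℕ} (c : ℕ → Fin m) {i j : ℕ} (hij : i ≤ j) :
    Del c i j = ascents c j - ascents c i :=
  Finset.sum_Ico_eq_sub _ hij

lemma psi_eq {m : ℕ} (l : ℕ → ℤ) (c : ℕ → Fin m) (j i : ℕ) :
    psi l c j i = (l j + ascents c j) - (l i + ascents c i) := by
  unfold psi
  split_ifs with h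
  · rw [Del_eq_ascents_sub c h]; ring
  · rw [Del_eq_ascents_sub c (by omega : i ≤ j)]; ring

/-- Induction along the first indices of the parts, where an index in `J` carries a part of
length one and an index in `I` a part of length two. -/
lemma part_induction {I J : Finset ℕ} {s : ℕ}
    (hd1 : Disjoint I (I.image (· + 1))) (hd3 : Disjoint (I.image (· + 1)) J)
    (hcover : I ∪ I.image (· + 1) ∪ J = Finset.Icc 1 s)
    {a : ℕ} (ha : a ∈ I ∪ J) {Q : ℕ → Prop} (base : Q a)
    (stepJ : ∀ k ∈ J, a ≤ k → k + 1 ∈ I ∪ J → Q k → Q (k + 1))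
    (stepI : ∀ k ∈ I, a ≤ k → k + 2 ∈ I ∪ J → Q k → Q (k + 2)) :
    ∀ k ∈ I ∪ J, a ≤ k → Q k := by
  have hmem (x : ℕ) : (x ∈ I ∨ x ∈ I.image (· + 1)) ∨ x ∈ J ↔ 1 ≤ x ∧ x ≤ s := by
    rw [← Finset.mem_union, ← Finset.mem_union, hcover, Finset.mem_Icc]
  have hsucc (x : ℕ) (hx : x ∈ I ∪ J) : x ∉ I.image (· + 1) := fun h =>
    (Finset.mem_union.mp hx).elim (fun hI => Finset.disjoint_left.mp hd1 hI h)
      (Finset.disjoint_left.mp hd3 h)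
  intro k
  induction k using Nat.strong_induction_on with
  | _ k ih =>
    intro hk hak
    obtain rfl | hlt := hak.eq_or_lt
    · exact base
    obtain ⟨n, rfl⟩ : ∃ n, k = n + 1 := ⟨k - 1, by omega⟩
    have hks := (hmem (n + 1)).mp (by have := Finset.mem_union.mp hk; tauto)
    have has := (hmem a).mp (by have := Finset.mem_union.mp ha; tauto)
    rcases (hmem n).mpr ⟨by omega, by omega⟩ with (hn | hn) | hn
    · exact absurd (Finset.mem_image_of_mem _ hn) (hsucc _ hk)
    · have han : a ≠ n := by
        rintro rfl
        exact hsucc _ ha hn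
      obtain ⟨i, hi, rfl⟩ := Finset.mem_image.mp hn
      exact stepI i hi (by omega) hk
        (ih i (by omega) (Finset.mem_union_left _ hi) (by omega))
    · exact stepJ n hn (by omega) hk
        (ih n (by omega) (Finset.mem_union_right _ hn) (by omega))

/-- Monotonicity of the gauge function ψ: decreasing in its first argument (in J)
and increasing in its second argument (in I). -/
theorem psi_monotone (m : ℕ) (hm : 1 ≤ m) (s : ℕ) (hs : 1 ≤ s)
    (l : ℕ → ℤ) (c : ℕ → Fin m) (I J : Finset ℕ)
    (hpos : ∀ k ∈ Finset.Icc 1 s, 1 ≤ l k)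
    (hd1 : Disjoint I (I.image (· + 1))) (hd2 : Disjoint I J)
    (hd3 : Disjoint (I.image (· + 1)) J)
    (hcover : I ∪ I.image (· + 1) ∪ J = Finset.Icc 1 s)
    (hI : ∀ i ∈ I, l i = l (i + 1) + delta (c i) (c (i + 1)))
    (hchainJ : ∀ j ∈ J, j + 1 ≤ s → gg (partAt l c J j) (partAt l c J (j + 1)))
    (hchainI : ∀ i ∈ I, i + 2 ≤ s → gg (partAt l c J i) (partAt l c J (i + 2))) :
    (∀ j ∈ J, ∀ j' ∈ J, ∀ i ∈ I, j ≤ j' → psi l c j i ≥ psi l c j' i) ∧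
    (∀ j ∈ J, ∀ i ∈ I, ∀ i' ∈ I, i ≤ i' → psi l c j i' ≥ psi l c j i) := by
  have hle (k : ℕ) (hk : k ∈ I ∪ J) : 1 ≤ k ∧ k ≤ s := by
    rw [← Finset.mem_Icc, ← hcover]
    simp only [Finset.mem_union] at hk ⊢
    tauto
  have partJ (k : ℕ) (hk : k ∈ J) : partAt l c J k = .primary (l k) (c k) := if_pos hk
  have partI (k : ℕ) (hk : k ∈ I) :
      partAt l c J k = .secondary (l (k + 1)) (c k) (c (k + 1)) :=
    if_neg (Finset.disjoint_left.mp hd2 hk)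
  have JJ (k : ℕ) (hk : k ∈ J) (hk' : k + 1 ∈ J) :
      l (k + 1) + 1 + delta (c k) (c (k + 1)) ≤ l k := by
    have h := hchainJ k hk (hle _ (Finset.mem_union_right _ hk')).2
    rw [partJ k hk, partJ _ hk'] at h
    simp only [gg] at h
    linarith
  have JI (k : ℕ) (hk : k ∈ J) (hk' : k + 1 ∈ I) :
      2 * l (k + 1) + delta (c k) (c (k + 1)) ≤ l k := by
    have h := hchainJ k hk (hle _ (Finset.mem_union_left _ hk')).2
    rw [partJ k hk, partI _ hk'] at h
    simp only [gg] at h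
    linarith [hI _ hk']
  have IJ (k : ℕ) (hk : k ∈ I) (hk' : k + 2 ∈ J) :
      l (k + 2) + 1 + delta (c (k + 1)) (c (k + 2)) ≤ 2 * l (k + 1) := by
    have h := hchainI k hk (hle _ (Finset.mem_union_right _ hk')).2
    rw [partI k hk, partJ _ hk'] at h
    simp only [gg] at h
    linarith
  have II (k : ℕ) (hk : k ∈ I) (hk' : k + 2 ∈ I) :
      l (k + 2) + delta (c (k + 1)) (c (k + 2)) ≤ l (k + 1) := by
    have h := hchainI k hk (hle _ (Finset.mem_union_left _ hk')).2
    rw [partI k hk, partI _ hk'] at h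
    simp only [gg] at h
    linarith [hI _ hk']
  have hA (k : ℕ) := ascents_succ c k
  have hδ (k : ℕ) := delta_nonneg (c k) (c (k + 1))
  constructor
  · intro j hj j' hj' i _ hjj'
    rw [psi_eq, psi_eq]
    have key := part_induction hd1 hd3 hcover (Finset.mem_union_right _ hj)
      (Q := fun k => (k ∈ J → l k + ascents c k ≤ l j + ascents c j) ∧
        (k ∈ I → 2 * l k + ascents c k ≤ l j + ascents c j))
      ⟨fun _ => le_rfl, fun h => absurd hj (Finset.disjoint_left.mp hd2 h)⟩
      (fun k hk _ _ ih => ⟨fun hk' => by linarith [ih.1 hk, JJ k hk hk', hA k],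
        fun hk' => by linarith [ih.1 hk, JI k hk hk', hA k]⟩)
      (fun k hk _ _ ih => ⟨
        fun hk' => by linarith [ih.2 hk, IJ k hk hk', hA k, hA (k + 1), hδ k, hI k hk],
        fun hk' => by
          linarith [ih.2 hk, II k hk hk', hA k, hA (k + 1), hδ k, hδ (k + 1), hI k hk]⟩)
      j' (Finset.mem_union_right _ hj') hjj'
    linarith [key.1 hj']
  · intro j _ i hi i' hi' hii'
    rw [psi_eq, psi_eq]
    -- For `k ∈ J`, compare with the last index `n ∈ I` before `k`.
    have key := part_induction hd1 hd3 hcover (Finset.mem_union_left _ hi)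
      (Q := fun k => (k ∈ I → l k + ascents c k ≤ l i + ascents c i) ∧
        (k ∈ J → ∃ n ∈ I, n + 1 ≤ k ∧ l n + ascents c n ≤ l i + ascents c i ∧
          l k + (k - n - 1) + (ascents c k - ascents c (n + 1)) ≤ 2 * l (n + 1)))
      ⟨fun _ => le_rfl, fun h => absurd h (Finset.disjoint_left.mp hd2 hi)⟩
      (fun k hk _ _ ih => by
        obtain ⟨n, hn, hnk, hni, hkn⟩ := ih.2 hk
        refine ⟨fun hk' => ?_, fun hk' => ⟨n, hn, by omega, hni, ?_⟩⟩
        · have := ascents_sub_le c (show n + 1 ≤ k + 1 by omega)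
          have := JI k hk hk'
          have := hA k
          have := hA n
          have := hI n hn
          push_cast at *
          omega
        · push_cast
          linarith [JJ k hk hk', hA k])
      (fun k hk _ _ ih => ⟨
        fun hk' => by linarith [ih.1 hk, II k hk hk', hA k, hA (k + 1), hI k hk],
        fun hk' => ⟨k, hk, by omega, ih.1 hk, by
          push_cast
          linarith [IJ k hk hk', hA (k + 1)]⟩⟩)
      i' (Finset.mem_union_left _ hi') hii'
    linarith [key.1 hi']
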